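/- arXiv:2206.13464 — 7 statements merged into one kernel-verified Lean document; each statement's English description precedes it below -/
import Mathlib

section
/- Let (Ω, μ) be a probability space and X : Ω → ℝ a real random variable such that a < X(ω) < b almost surely, where −∞ ≤ a < b ≤ ∞. Let φ : ℝ → ℝ be twice differentiable on (a, b), and suppose that X, X², and φ∘X are integrable, that a < E[X] < b, and that there exist real numbers m, M with m ≤ φ''(x) ≤ M for all x ∈ (a, b). Then (m/2)·Var(X) ≤ E[φ(X)] − φ(E[X]) ≤ (M/2)·Var(X). -/
open MeasureTheory

/-- A function whose second derivative is nonnegative on a convex set lies above each of its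
tangent lines there. -/
lemma tangent_le_of_hasDerivAt_two_nonneg {s : Set ℝ} (hs : Convex ℝ s)
    {g g' g'' : ℝ → ℝ} (hg' : ∀ x ∈ s, HasDerivAt g (g' x) x)
    (hg'' : ∀ x ∈ s, HasDerivAt g' (g'' x) x) (h0 : ∀ x ∈ s, 0 ≤ g'' x)
    {c x : ℝ} (hc : c ∈ s) (hx : x ∈ s) : g c + g' c * (x - c) ≤ g x := by
  have hconv : ConvexOn ℝ s g :=
    convexOn_of_hasDerivWithinAt2_nonneg hs
      (fun y hy => (hg' y hy).continuousAt.continuousWithinAt)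
      (fun y hy => (hg' y (interior_subset hy)).hasDerivWithinAt)
      (fun y hy => (hg'' y (interior_subset hy)).hasDerivWithinAt)
      (fun y hy => h0 y (interior_subset hy))
  rcases lt_trichotomy c x with h | rfl | h
  · have := hconv.le_slope_of_hasDerivAt hc hx h (hg' c hc)
    rw [slope_def_field, le_div_iff₀ (sub_pos.2 h)] at this
    linarith
  · simp
  · have := hconv.slope_le_of_hasDerivAt hx hc h (hg' c hc)
    rw [slope_def_field, div_le_iff₀ (sub_pos.2 h)] at this
    linarith

/-- Second-order lower bound at `c` for a function with second derivative at least `m`. -/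
lemma taylor_two_le_of_le_hasDerivAt_two {s : Set ℝ} (hs : Convex ℝ s)
    {f f' f'' : ℝ → ℝ} {m : ℝ} (hf' : ∀ x ∈ s, HasDerivAt f (f' x) x)
    (hf'' : ∀ x ∈ s, HasDerivAt f' (f'' x) x) (hm : ∀ x ∈ s, m ≤ f'' x)
    {c x : ℝ} (hc : c ∈ s) (hx : x ∈ s) :
    f c + f' c * (x - c) + m / 2 * (x - c) ^ 2 ≤ f x := by
  have := tangent_le_of_hasDerivAt_two_nonneg hs
    (g := fun y => f y - m / 2 * (y - c) ^ 2) (g' := fun y => f' y - m * (y - c))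
    (g'' := fun y => f'' y - m)
    (fun y hy => by
      have h := (hf' y hy).sub ((((hasDerivAt_id y).sub_const c).pow 2).const_mul (m / 2))
      refine h.congr_deriv ?_
      simp
      ring)
    (fun y hy => by
      have h := (hf'' y hy).sub (((hasDerivAt_id y).sub_const c).const_mul m)
      exact h.congr_deriv (by simp))
    (fun y hy => sub_nonneg.2 (hm y hy)) hc hx
  simp only [sub_self] at this
  linarith

/-- Jensen's inequality with a variance term, for a function with second derivative at
least `m`. -/
lemma mul_integral_sq_le_integral_comp_sub {Ω : Type*} [MeasurableSpace Ω] {μ : Measure Ω}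
    [IsProbabilityMeasure μ] {X : Ω → ℝ} {s : Set ℝ} (hs : Convex ℝ s)
    (hX : ∀ᵐ ω ∂μ, X ω ∈ s) {f f' f'' : ℝ → ℝ} {m : ℝ}
    (hf' : ∀ x ∈ s, HasDerivAt f (f' x) x) (hf'' : ∀ x ∈ s, HasDerivAt f' (f'' x) x)
    (hm : ∀ x ∈ s, m ≤ f'' x) (hXint : Integrable X μ)
    (hX2int : Integrable (fun ω => X ω ^ 2) μ) (hfXint : Integrable (fun ω => f (X ω)) μ)
    (hEX : ∫ ω, X ω ∂μ ∈ s) :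
    m / 2 * (∫ ω, (X ω - ∫ ω', X ω' ∂μ) ^ 2 ∂μ) ≤
      (∫ ω, f (X ω) ∂μ) - f (∫ ω, X ω ∂μ) := by
  set c := ∫ ω, X ω ∂μ with hc
  have hlin : Integrable (fun ω => X ω - c) μ := hXint.sub (integrable_const c)
  have hsq : Integrable (fun ω => (X ω - c) ^ 2) μ := by
    refine ((hX2int.sub (hXint.const_mul (2 * c))).add (integrable_const (c ^ 2))).congr ?_
    filter_upwards with ω
    simp only [Pi.add_apply, Pi.sub_apply]
    ring
  have hlin0 : ∫ ω, (X ω - c) ∂μ = 0 := by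
    rw [integral_sub hXint (integrable_const c)]
    simp [hc]
  have haff : Integrable (fun ω => f c + f' c * (X ω - c)) μ :=
    (integrable_const _).add (hlin.const_mul _)
  have hle : ∫ ω, (f c + f' c * (X ω - c) + m / 2 * (X ω - c) ^ 2) ∂μ ≤ ∫ ω, f (X ω) ∂μ := by
    refine integral_mono_ae (haff.add (hsq.const_mul _)) hfXint ?_
    filter_upwards [hX] with ω hω
    exact taylor_two_le_of_le_hasDerivAt_two hs hf' hf'' hm hEX hω
  rw [integral_add haff (hsq.const_mul _), integral_add (integrable_const _) (hlin.const_mul _),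
    integral_const_mul, integral_const_mul, hlin0] at hle
  simp only [integral_const, probReal_univ, one_smul, mul_zero, add_zero] at hle
  linarith

/-- Sharpened Jensen's inequality (Lemma 1): if `a < X < b` a.s., `φ` is twice
differentiable on `(a, b)` with `m ≤ φ'' ≤ M` there, and `X`, `X²`, `φ ∘ X` are
integrable with `a < E[X] < b`, then
`(m/2)·Var(X) ≤ E[φ(X)] − φ(E[X]) ≤ (M/2)·Var(X)`. -/
theorem sharpened_jensen {Ω : Type*} [MeasurableSpace Ω] (μ : Measure Ω)
    [IsProbabilityMeasure μ] (X : Ω → ℝ) (a b : EReal) (hab : a < b)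
    (hX : ∀ᵐ ω ∂μ, a < (X ω : EReal) ∧ (X ω : EReal) < b)
    (φ φ' φ'' : ℝ → ℝ)
    (hφ' : ∀ x : ℝ, a < (x : EReal) → (x : EReal) < b → HasDerivAt φ (φ' x) x)
    (hφ'' : ∀ x : ℝ, a < (x : EReal) → (x : EReal) < b → HasDerivAt φ' (φ'' x) x)
    (hXint : Integrable X μ)
    (hX2int : Integrable (fun ω => (X ω) ^ 2) μ)
    (hφXint : Integrable (fun ω => φ (X ω)) μ)
    (hEXa : a < ((∫ ω, X ω ∂μ : ℝ) : EReal))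
    (hEXb : ((∫ ω, X ω ∂μ : ℝ) : EReal) < b)
    (m M : ℝ)
    (hmM : ∀ x : ℝ, a < (x : EReal) → (x : EReal) < b → m ≤ φ'' x ∧ φ'' x ≤ M) :
    m / 2 * (∫ ω, (X ω - ∫ ω', X ω' ∂μ) ^ 2 ∂μ) ≤
        (∫ ω, φ (X ω) ∂μ) - φ (∫ ω, X ω ∂μ) ∧
      (∫ ω, φ (X ω) ∂μ) - φ (∫ ω, X ω ∂μ) ≤
        M / 2 * (∫ ω, (X ω - ∫ ω', X ω' ∂μ) ^ 2 ∂μ) := by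
  let s : Set ℝ := {x : ℝ | a < (x : EReal) ∧ (x : EReal) < b}
  have hs : Convex ℝ s := by
    refine Set.OrdConnected.convex ⟨fun x hx y hy z hz => ⟨hx.1.trans_le ?_, lt_of_le_of_lt ?_ hy.2⟩⟩
    · exact EReal.coe_le_coe_iff.2 hz.1
    · exact EReal.coe_le_coe_iff.2 hz.2
  refine ⟨mul_integral_sq_le_integral_comp_sub hs hX (fun x hx => hφ' x hx.1 hx.2)
    (fun x hx => hφ'' x hx.1 hx.2) (fun x hx => (hmM x hx.1 hx.2).1) hXint hX2int hφXint
    ⟨hEXa, hEXb⟩, ?_⟩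
  have h := mul_integral_sq_le_integral_comp_sub (f := fun x => -φ x) (f' := fun x => -φ' x)
    (f'' := fun x => -φ'' x) (m := -M) hs hX (fun x hx => (hφ' x hx.1 hx.2).neg)
    (fun x hx => (hφ'' x hx.1 hx.2).neg) (fun x hx => neg_le_neg (hmM x hx.1 hx.2).2)
    hXint hX2int hφXint.neg ⟨hEXa, hEXb⟩
  rw [integral_neg] at h
  linarith
end

section
/- Let X be a finite nonempty type, ω a pmf on X, Q : X → ℝ, and Q_min ∈ ℝ with Q_min ≤ Q x for every x. Then E_ω[Q] ≤ log (∑ x, ω x * exp (Q x)) ≤ E_ω[Q] + Var_ω[fun x => exp (Q x)] / (2 * exp (2 * Q_min)). -/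
open Real

/-- Adding the quadratic `y ^ 2 / (2 * m ^ 2)` makes the logarithm convex on `[m, ∞)`. -/
theorem convexOn_log_add_sq_div {m : ℝ} (hm : 0 < m) :
    ConvexOn ℝ (Set.Ici m) fun y => Real.log y + y ^ 2 / (2 * m ^ 2) := by
  refine convexOn_of_hasDerivWithinAt2_nonneg (f' := fun y => y⁻¹ + y / m ^ 2)
    (f'' := fun y => -(y ^ 2)⁻¹ + 1 / m ^ 2) (convex_Ici m) ?_ ?_ ?_ ?_
  · refine ContinuousOn.add (ContinuousOn.log continuousOn_id fun y hy => ?_) (by fun_prop)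
    exact (hm.trans_le hy).ne'
  all_goals
    intro y hy
    rw [interior_Ici] at hy
    have hy' : m < y := hy
    have hy0 : 0 < y := hm.trans hy'
  · refine ((Real.hasDerivAt_log hy0.ne').add
      ((hasDerivAt_pow 2 y).div_const (2 * m ^ 2))).hasDerivWithinAt.congr_deriv ?_
    simp only [Nat.cast_ofNat, Nat.add_one_sub_one, pow_one]
    field_simp
  · exact ((hasDerivAt_inv hy0.ne').add ((hasDerivAt_id y).div_const (m ^ 2))).hasDerivWithinAt
  · have h : (y ^ 2)⁻¹ ≤ (m ^ 2)⁻¹ := by gcongr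
    simpa [one_div] using h

/-- The variance of a function under a pmf is the second moment minus the squared mean. -/
theorem sum_mul_sub_mean_sq {X : Type*} [Fintype X] {ω : X → ℝ} (hω1 : ∑ x, ω x = 1)
    (f : X → ℝ) :
    ∑ x, ω x * (f x - ∑ y, ω y * f y) ^ 2 = ∑ x, ω x * f x ^ 2 - (∑ x, ω x * f x) ^ 2 := by
  set M := ∑ y, ω y * f y with hM
  have h : ∀ x, ω x * (f x - M) ^ 2 = ω x * f x ^ 2 - 2 * M * (ω x * f x) + M ^ 2 * ω x :=
    fun x => by ring
  simp only [h, Finset.sum_add_distrib, Finset.sum_sub_distrib, ← Finset.mul_sum, hω1, ← hM]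
  ring

/-- Corollary 1: the weighted log-sum-exp of `Q` under a pmf `ω` is sandwiched
between the `ω`-mean of `Q` and the `ω`-mean plus a variance correction. -/
theorem weighted_log_sum_exp_bounds {X : Type*} [Fintype X] [Nonempty X]
    (ω : X → ℝ) (hω0 : ∀ x, 0 ≤ ω x) (hω1 : ∑ x, ω x = 1)
    (Q : X → ℝ) (Qmin : ℝ) (hQmin : ∀ x, Qmin ≤ Q x) :
    (∑ x, ω x * Q x) ≤ Real.log (∑ x, ω x * Real.exp (Q x)) ∧
      Real.log (∑ x, ω x * Real.exp (Q x)) ≤ (∑ x, ω x * Q x) +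
        (∑ x, ω x * (Real.exp (Q x) - ∑ y, ω y * Real.exp (Q y)) ^ 2) /
          (2 * Real.exp (2 * Qmin)) := by
  have hexp : Real.exp (∑ x, ω x * Q x) ≤ ∑ x, ω x * Real.exp (Q x) := by
    simpa only [smul_eq_mul] using convexOn_exp.map_sum_le (t := Finset.univ) (w := ω) (p := Q)
      (fun x _ => hω0 x) hω1 (fun x _ => Set.mem_univ _)
  refine ⟨(Real.le_log_iff_exp_le ((Real.exp_pos _).trans_le hexp)).2 hexp, ?_⟩
  have hJensen := (convexOn_log_add_sq_div (Real.exp_pos Qmin)).map_sum_le (t := Finset.univ)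
    (w := ω) (p := fun x => Real.exp (Q x)) (fun x _ => hω0 x) hω1
    (fun x _ => Real.exp_le_exp.2 (hQmin x))
  simp only [smul_eq_mul, Real.log_exp, mul_add, Finset.sum_add_distrib, ← mul_div_assoc,
    ← Finset.sum_div] at hJensen
  have hsq : Real.exp (2 * Qmin) = Real.exp Qmin ^ 2 := by
    rw [← Real.exp_nat_mul, Nat.cast_ofNat]
  rw [sum_mul_sub_mean_sq hω1, hsq, sub_div]
  linarith
end

section
/- Let A be a nonempty finite type, d_M ≥ 0 and d_B ≥ 0 real numbers, and ρ : A → ℝ with ρ a > 0 for all a; assume D a := d_M * ρ a + d_B > 0 for all a. Let C = d_M * (max over a of ρ a) + d_B and ζ a = C / D a. Then ζ a ≥ 1 for every a; and for all ω, d_D : A → ℝ with ω a ≥ 0 and d_D a ≥ 0 for all a, if ∑ a, ω a > ∑ a, d_D a * ζ a, then ∑ a, (ω a − d_D a) / D a > 0. -/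
/-- Core inequality behind Theorem 1: with `ζ a = C / D a ≥ 1`, the condition
`∑ ω > ∑ d_D · ζ` forces the per-state penalty `∑ (ω − d_D)/D` to be positive. -/
theorem penalty_positive {A : Type*} [Fintype A] [Nonempty A]
    (dM dB : ℝ) (hdM : 0 ≤ dM) (hdB : 0 ≤ dB)
    (ρ : A → ℝ) (hρ : ∀ a, 0 < ρ a)
    (D : A → ℝ) (hD : ∀ a, D a = dM * ρ a + dB) (hDpos : ∀ a, 0 < D a)
    (C : ℝ) (hC : C = dM * (Finset.univ.sup' Finset.univ_nonempty ρ) + dB)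
    (ζ : A → ℝ) (hζ : ∀ a, ζ a = C / D a) :
    (∀ a, 1 ≤ ζ a) ∧
      ∀ ω dD : A → ℝ, (∀ a, 0 ≤ ω a) → (∀ a, 0 ≤ dD a) →
        (∑ a, ω a > ∑ a, dD a * ζ a) → 0 < ∑ a, (ω a - dD a) / D a := by
  have hDC : ∀ a, D a ≤ C := fun a => by
    rw [hD, hC]
    gcongr
    exact Finset.le_sup' ρ (Finset.mem_univ a)
  have hζ_one : ∀ a, 1 ≤ ζ a := fun a => by
    rw [hζ, one_le_div (hDpos a)]
    exact hDC a
  refine ⟨hζ_one, fun ω dD hω _ h => ?_⟩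
  have hCpos : 0 < C := (hDpos _).trans_le (hDC (Classical.arbitrary A))
  refine pos_of_mul_pos_right ?_ hCpos.le
  calc 0 < ∑ a, ω a - ∑ a, dD a * ζ a := sub_pos.mpr h
    _ = ∑ a, (ω a - dD a * ζ a) := Finset.sum_sub_distrib _ _ |>.symm
    _ ≤ ∑ a, C * ((ω a - dD a) / D a) := by
      refine Finset.sum_le_sum fun a _ => ?_
      have hmul : C * ((ω a - dD a) / D a) = ω a * ζ a - dD a * ζ a := by
        rw [hζ]
        ring
      rw [hmul]
      gcongr
      exact le_mul_of_one_le_right (hω a) (hζ_one a)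
    _ = C * ∑ a, (ω a - dD a) / D a := (Finset.mul_sum _ _ _).symm
end

section
/- (Theorem 1, tabular form.) Let S and A be nonempty finite types. Let π, π_D : S → A → ℝ with π s a > 0 and π_D s a ≥ 0 for all s, a; let d_M, d_B : S → ℝ with d_M s ≥ 0 and d_B s ≥ 0; let ω : S → A → ℝ with ω s a ≥ 0. Define ρ s a = π_D s a / π s a, D s a = d_M s * ρ s a + d_B s (assumed > 0 for all s, a), d_D s a = d_M s * π_D s a, C s = d_M s * (max over a of ρ s a) + d_B s, ζ s a = C s / D s a, and Δ s = ∑ a, (ω s a − d_D s a) / D s a. Let P : S → S → ℝ be row-stochastic, r : S → ℝ, γ ∈ [0, 1), and β > 0. Assume Δ s' ≥ 0 for every state s'. Let V^π be the unique fixed point of V ↦ (fun s => r s + γ * ∑ s', P s s' * V s') and let V̂ be the unique fixed point of V ↦ (fun s => r s + γ * ∑ s', P s s' * V s' − β * Δ s). If a state s satisfies ∑ a, ω s a > ∑ a, d_D s a * ζ s a, then V̂ s < V^π s. -/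
/-- A solution of a discounted linear system with nonnegative kernel and nonnegative source
dominates its source. -/
theorem source_le_of_discounted_eq {S : Type*} [Fintype S] [Nonempty S]
    {P : S → S → ℝ} (hP0 : ∀ s s', 0 ≤ P s s') (hP1 : ∀ s, ∑ s', P s s' = 1)
    {γ : ℝ} (hγ0 : 0 ≤ γ) (hγ1 : γ < 1) {c W : S → ℝ} (hc : ∀ s, 0 ≤ c s)
    (hW : ∀ s, W s = γ * (∑ s', P s s' * W s') + c s) (s : S) : c s ≤ W s := by
  obtain ⟨m, hm⟩ := Finite.exists_min W
  have hWm : 0 ≤ W m := by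
    have h : W m ≤ ∑ s', P m s' * W s' := by
      calc W m = ∑ s', P m s' * W m := by rw [← Finset.sum_mul, hP1, one_mul]
        _ ≤ _ := Finset.sum_le_sum fun s' _ => mul_le_mul_of_nonneg_left (hm s') (hP0 m s')
    nlinarith [mul_le_mul_of_nonneg_left h hγ0, hW m, hc m]
  have hsum : 0 ≤ ∑ s', P s s' * W s' :=
    Finset.sum_nonneg fun s' _ => mul_nonneg (hP0 s s') (hWm.trans (hm s'))
  linarith [hW s, mul_nonneg hγ0 hsum]

/-- If `C` bounds the positive denominators `D` and the total of `w` exceeds the `C / D`-weighted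
total of `d`, then the weighted gap `∑ (w - d) / D` is positive. -/
theorem sum_sub_div_pos {A : Type*} [Fintype A] [Nonempty A] {w d D : A → ℝ} {C : ℝ}
    (hw : ∀ a, 0 ≤ w a) (hD : ∀ a, 0 < D a) (hC : ∀ a, D a ≤ C)
    (h : ∑ a, d a * (C / D a) < ∑ a, w a) : 0 < ∑ a, (w a - d a) / D a := by
  obtain ⟨a₀⟩ := ‹Nonempty A›
  have hCpos : 0 < C := (hD a₀).trans_le (hC a₀)
  have hle : ∑ a, w a ≤ ∑ a, w a * (C / D a) := Finset.sum_le_sum fun a _ =>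
    le_mul_of_one_le_right (hw a) ((one_le_div (hD a)).2 (hC a))
  have heq : C * ∑ a, (w a - d a) / D a = ∑ a, w a * (C / D a) - ∑ a, d a * (C / D a) := by
    rw [Finset.mul_sum, ← Finset.sum_sub_distrib]
    exact Finset.sum_congr rfl fun a _ => by ring
  refine pos_of_mul_pos_right (a := C) ?_ hCpos.le
  linarith

/-- Theorem 1 (tabular form): the value function learned via the approximated
dynamics-aware policy evaluation lower bounds the actual value function at high
dynamics-gap states, i.e. states with `∑_a ω(s,a) > ∑_a d_D(s,a)·ζ(s,a)`. -/
theorem value_lower_bound_high_gap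
    {S A : Type*} [Fintype S] [Nonempty S] [Fintype A] [Nonempty A]
    (π πD : S → A → ℝ) (hπ : ∀ s a, 0 < π s a) (hπD : ∀ s a, 0 ≤ πD s a)
    (dM dB : S → ℝ) (hdM : ∀ s, 0 ≤ dM s) (hdB : ∀ s, 0 ≤ dB s)
    (ω : S → A → ℝ) (hω : ∀ s a, 0 ≤ ω s a)
    (ρ : S → A → ℝ) (hρ : ∀ s a, ρ s a = πD s a / π s a)
    (D : S → A → ℝ) (hD : ∀ s a, D s a = dM s * ρ s a + dB s)
    (hDpos : ∀ s a, 0 < D s a)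
    (dD : S → A → ℝ) (hdD : ∀ s a, dD s a = dM s * πD s a)
    (C : S → ℝ)
    (hC : ∀ s, C s = dM s * (Finset.univ.sup' Finset.univ_nonempty (ρ s)) + dB s)
    (ζ : S → A → ℝ) (hζ : ∀ s a, ζ s a = C s / D s a)
    (Δ : S → ℝ) (hΔ : ∀ s, Δ s = ∑ a, (ω s a - dD s a) / D s a)
    (P : S → S → ℝ) (hP0 : ∀ s s', 0 ≤ P s s') (hP1 : ∀ s, ∑ s', P s s' = 1)
    (r : S → ℝ) (γ : ℝ) (hγ0 : 0 ≤ γ) (hγ1 : γ < 1) (β : ℝ) (hβ : 0 < β)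
    (hΔ0 : ∀ s', 0 ≤ Δ s')
    (Vπ : S → ℝ) (hVπ : ∀ s, Vπ s = r s + γ * ∑ s', P s s' * Vπ s')
    (Vhat : S → ℝ)
    (hVhat : ∀ s, Vhat s = r s + γ * (∑ s', P s s' * Vhat s') - β * Δ s)
    (s : S) (hs : ∑ a, ω s a > ∑ a, dD s a * ζ s a) :
    Vhat s < Vπ s := by
  have hgap : 0 < Δ s := by
    rw [hΔ]
    refine sum_sub_div_pos (C := C s) (hω s) (hDpos s) (fun a => ?_) (by simpa only [hζ] using hs)
    rw [hD, hC]
    gcongr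
    · exact hdM s
    · exact Finset.le_sup' (ρ s) (Finset.mem_univ a)
  have h := source_le_of_discounted_eq hP0 hP1 hγ0 hγ1 (c := fun t => β * Δ t)
    (W := fun t => Vπ t - Vhat t) (fun t => mul_nonneg hβ.le (hΔ0 t)) (fun t => by
      simp only [mul_sub, Finset.sum_sub_distrib]
      linarith [hVπ t, hVhat t]) s
  linarith [mul_pos hβ hgap]
end

section
/- Let S be a nonempty finite type, P : S → S → ℝ a row-stochastic matrix, γ ∈ [0, 1), r : S → ℝ, and g : S → ℝ with g s ≥ 0 for all s. Let V^π be the unique fixed point of V ↦ (fun s => r s + γ * ∑ s', P s s' * V s'). If V̂ : S → ℝ satisfies V̂ s ≤ r s + γ * (∑ s', P s s' * V̂ s') − g s for every s, then V̂ s ≤ V^π s − g s for every s. -/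
/-- A subsolution of the homogeneous discounted Bellman equation is nonpositive. -/
theorem nonpos_of_le_discounted_sum
    {S : Type*} [Fintype S]
    {P : S → S → ℝ} (hP0 : ∀ s s', 0 ≤ P s s') (hP1 : ∀ s, ∑ s', P s s' = 1)
    {γ : ℝ} (hγ0 : 0 ≤ γ) (hγ1 : γ < 1) {D : S → ℝ}
    (hD : ∀ s, D s ≤ γ * ∑ s', P s s' * D s') (s : S) : D s ≤ 0 := by
  have : Nonempty S := ⟨s⟩
  obtain ⟨m, hm⟩ := Finite.exists_max D
  have hsum : ∑ s', P m s' * D s' ≤ D m := by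
    calc ∑ s', P m s' * D s' ≤ ∑ s', P m s' * D m :=
          Finset.sum_le_sum fun s' _ => mul_le_mul_of_nonneg_left (hm s') (hP0 m s')
      _ = D m := by rw [← Finset.sum_mul, hP1, one_mul]
  have hmul := mul_le_mul_of_nonneg_left hsum hγ0
  have hDm := hD m
  refine (hm s).trans ?_
  nlinarith

/-- Monotone comparison principle: if `V̂` satisfies the penalized Bellman
inequality `V̂ s ≤ r s + γ ∑ P s s' V̂ s' − g s` with a nonnegative penalty `g`,
then `V̂ s ≤ V^π s − g s` for every state `s`. -/
theorem penalized_bellman_comparison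
    {S : Type*} [Fintype S] [Nonempty S]
    (P : S → S → ℝ) (hP0 : ∀ s s', 0 ≤ P s s') (hP1 : ∀ s, ∑ s', P s s' = 1)
    (γ : ℝ) (hγ0 : 0 ≤ γ) (hγ1 : γ < 1) (r : S → ℝ)
    (g : S → ℝ) (hg : ∀ s, 0 ≤ g s)
    (Vπ : S → ℝ) (hVπ : ∀ s, Vπ s = r s + γ * ∑ s', P s s' * Vπ s')
    (Vhat : S → ℝ)
    (hVhat : ∀ s, Vhat s ≤ r s + γ * (∑ s', P s s' * Vhat s') - g s) :
    ∀ s, Vhat s ≤ Vπ s - g s := by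
  have hdiff (s : S) : Vhat s - Vπ s ≤ γ * ∑ s', P s s' * (Vhat s' - Vπ s') - g s := by
    simp only [mul_sub, Finset.sum_sub_distrib]
    linarith [hVhat s, hVπ s]
  have hnonpos := nonpos_of_le_discounted_sum hP0 hP1 hγ0 hγ1
    (D := fun s => Vhat s - Vπ s) fun s => (hdiff s).trans (sub_le_self _ (hg s))
  intro s
  have hsum : ∑ s', P s s' * (Vhat s' - Vπ s') ≤ 0 :=
    Finset.sum_nonpos fun s' _ => mul_nonpos_of_nonneg_of_nonpos (hP0 s s') (hnonpos s')
  linarith [hdiff s, mul_nonpos_of_nonneg_of_nonpos hγ0 hsum]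
end

section
/- (Theorem 2, tabular form.) Let S and A be nonempty finite types. Let π, π_D : S → A → ℝ with π s a > 0 and π_D s a ≥ 0 for all s, a; let d_M, d_B : S → ℝ with d_M s ≥ 0 and d_B s ≥ 0; let ω : S → A → ℝ with ω s a ≥ 0. Define ρ s a = π_D s a / π s a, D s a = d_M s * ρ s a + d_B s (assumed > 0 for all s, a), d_D s a = d_M s * π_D s a, C s = d_M s * (max over a of ρ s a) + d_B s, ζ s a = C s / D s a, and Δ s = ∑ a, (ω s a − d_D s a) / D s a. Let P : S → S → ℝ be row-stochastic, r : S → ℝ, γ ∈ [0, 1), β > 0, and ε : S → ℝ a sampling-error bound with ε s ≥ 0 for all s. Assume β * Δ s' ≥ ε s' for every state s'. Let V^π be the unique fixed point of V ↦ (fun s => r s + γ * ∑ s', P s s' * V s'), and suppose V̂ : S → ℝ satisfies V̂ s ≤ r s + γ * (∑ s', P s s' * V̂ s') − β * Δ s + ε s for every s. If a state s satisfies ∑ a, ω s a > ∑ a, d_D s a * ζ s a + ε s * C s / β, then V̂ s < V^π s. -/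
/-- A function dominated by its discounted average under a stochastic matrix is nonpositive. -/
theorem nonpos_of_le_discounted_average {S : Type*} [Fintype S] [Nonempty S]
    (P : S → S → ℝ) (hP0 : ∀ s s', 0 ≤ P s s') (hP1 : ∀ s, ∑ s', P s s' = 1)
    {γ : ℝ} (hγ0 : 0 ≤ γ) (hγ1 : γ < 1) (W : S → ℝ)
    (hW : ∀ s, W s ≤ γ * ∑ s', P s s' * W s') (s : S) : W s ≤ 0 := by
  obtain ⟨m, hm⟩ := Finite.exists_max W
  have havg : ∑ s', P m s' * W s' ≤ W m :=
    calc ∑ s', P m s' * W s' ≤ ∑ s', P m s' * W m :=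
          Finset.sum_le_sum fun s' _ => mul_le_mul_of_nonneg_left (hm s') (hP0 m s')
      _ = W m := by rw [← Finset.sum_mul, hP1, one_mul]
  have hWm : W m ≤ γ * W m := (hW m).trans (mul_le_mul_of_nonneg_left havg hγ0)
  have hWm0 : W m ≤ 0 := by
    by_contra! h
    nlinarith
  exact (hm s).trans hWm0

/-- A gap in total mass, weighted by `c / D` with `D ≤ c`, bounds the sum of relative
differences from below. -/
theorem lt_sum_sub_div_of_weighted_gap {A : Type*} [Fintype A] {ω d D : A → ℝ} {c t : ℝ}
    (hω : ∀ a, 0 ≤ ω a) (hD : ∀ a, 0 < D a) (hDc : ∀ a, D a ≤ c) (hc : 0 < c)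
    (h : (∑ a, d a * (c / D a)) + t * c < ∑ a, ω a) :
    t < ∑ a, (ω a - d a) / D a := by
  have hle : (∑ a, ω a) - ∑ a, d a * (c / D a) ≤ c * ∑ a, (ω a - d a) / D a := by
    rw [← Finset.sum_sub_distrib, Finset.mul_sum]
    refine Finset.sum_le_sum fun a _ => ?_
    have hone : 1 ≤ c / D a := (one_le_div (hD a)).2 (hDc a)
    calc ω a - d a * (c / D a) ≤ ω a * (c / D a) - d a * (c / D a) :=
          sub_le_sub_right (le_mul_of_one_le_right (hω a) hone) _
      _ = c * ((ω a - d a) / D a) := by ring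
  refine lt_of_mul_lt_mul_left ?_ hc.le
  linarith

/-- Theorem 2 (tabular form, with sampling error): if the learned value
function satisfies the penalized Bellman inequality up to a sampling error
`ε`, then it lower bounds the actual value function at states satisfying the
strengthened dynamics-gap condition `∑_a ω > ∑_a d_D·ζ + ε·C/β` (Eq. (22)). -/
theorem value_lower_bound_high_gap_sampling_error
    {S A : Type*} [Fintype S] [Nonempty S] [Fintype A] [Nonempty A]
    (π πD : S → A → ℝ) (hπ : ∀ s a, 0 < π s a) (hπD : ∀ s a, 0 ≤ πD s a)
    (dM dB : S → ℝ) (hdM : ∀ s, 0 ≤ dM s) (hdB : ∀ s, 0 ≤ dB s)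
    (ω : S → A → ℝ) (hω : ∀ s a, 0 ≤ ω s a)
    (ρ : S → A → ℝ) (hρ : ∀ s a, ρ s a = πD s a / π s a)
    (D : S → A → ℝ) (hD : ∀ s a, D s a = dM s * ρ s a + dB s)
    (hDpos : ∀ s a, 0 < D s a)
    (dD : S → A → ℝ) (hdD : ∀ s a, dD s a = dM s * πD s a)
    (C : S → ℝ)
    (hC : ∀ s, C s = dM s * (Finset.univ.sup' Finset.univ_nonempty (ρ s)) + dB s)
    (ζ : S → A → ℝ) (hζ : ∀ s a, ζ s a = C s / D s a)
    (Δ : S → ℝ) (hΔ : ∀ s, Δ s = ∑ a, (ω s a - dD s a) / D s a)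
    (P : S → S → ℝ) (hP0 : ∀ s s', 0 ≤ P s s') (hP1 : ∀ s, ∑ s', P s s' = 1)
    (r : S → ℝ) (γ : ℝ) (hγ0 : 0 ≤ γ) (hγ1 : γ < 1) (β : ℝ) (hβ : 0 < β)
    (ε : S → ℝ) (hε : ∀ s, 0 ≤ ε s)
    (hΔε : ∀ s', ε s' ≤ β * Δ s')
    (Vπ : S → ℝ) (hVπ : ∀ s, Vπ s = r s + γ * ∑ s', P s s' * Vπ s')
    (Vhat : S → ℝ)
    (hVhat : ∀ s, Vhat s ≤ r s + γ * (∑ s', P s s' * Vhat s') - β * Δ s + ε s)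
    (s : S) (hs : ∑ a, ω s a > (∑ a, dD s a * ζ s a) + ε s * C s / β) :
    Vhat s < Vπ s := by
  have hDC : ∀ a, D s a ≤ C s := fun a => by
    rw [hD, hC]
    gcongr
    · exact hdM s
    · exact Finset.le_sup' (ρ s) (Finset.mem_univ a)
  have hCpos : 0 < C s := (hDpos s (Classical.arbitrary A)).trans_le (hDC _)
  have hgap : ε s / β < Δ s := by
    rw [hΔ]
    refine lt_sum_sub_div_of_weighted_gap (hω s) (hDpos s) hDC hCpos ?_
    simpa only [hζ, div_mul_eq_mul_div] using hs
  have hpen : ε s < β * Δ s := by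
    rwa [div_lt_iff₀' hβ] at hgap
  have hstep : ∀ x, Vhat x - Vπ x ≤
      γ * (∑ y, P x y * (Vhat y - Vπ y)) - (β * Δ x - ε x) := fun x => by
    simp only [mul_sub, Finset.sum_sub_distrib]
    linarith [hVhat x, hVπ x]
  have hnonpos : ∀ x, Vhat x - Vπ x ≤ 0 :=
    nonpos_of_le_discounted_average P hP0 hP1 hγ0 hγ1 (fun x => Vhat x - Vπ x)
      fun x => (hstep x).trans (sub_le_self _ (sub_nonneg.2 (hΔε x)))
  have hsum : γ * ∑ y, P s y * (Vhat y - Vπ y) ≤ 0 :=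
    mul_nonpos_of_nonneg_of_nonpos hγ0 <| Finset.sum_nonpos fun y _ =>
      mul_nonpos_of_nonneg_of_nonpos (hP0 s y) (hnonpos y)
  linarith [hstep s]
end

section
/- Let S' be a nonempty finite type and q : Bool × S' → ℝ a pmf, interpreted as the joint distribution of a domain label (true = real, false = sim) and the next state, conditioned on a fixed state-action pair. Fix s' : S' and assume q (true, s') > 0 and ∑ t, q (false, t) > 0. Define P_sim s' = q (false, s') / (∑ t, q (false, t)), P_real s' = q (true, s') / (∑ t, q (true, t)), a = q (true, s') / (q (true, s') + q (false, s')) (the conditional probability of the real domain given (s, a, s')), and b = ∑ t, q (true, t) (the conditional probability of the real domain given (s, a)). Then P_sim s' / P_real s' = ((1 − a) / a) / ((1 − b) / b). -/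
/-- Bayes'-rule identity (Eq. (7)): the ratio between simulated and real
transition dynamics equals
`[(1 − p(real|s,a,s'))/p(real|s,a,s')] / [(1 − p(real|s,a))/p(real|s,a)]`. -/
theorem dynamics_ratio_bayes {S' : Type*} [Fintype S'] [Nonempty S']
    (q : Bool × S' → ℝ) (hq0 : ∀ x, 0 ≤ q x) (hq1 : ∑ x, q x = 1)
    (s' : S') (hqt : 0 < q (true, s')) (hqf : 0 < ∑ t, q (false, t))
    (Psim Preal : S' → ℝ)
    (hPsim : ∀ u, Psim u = q (false, u) / ∑ t, q (false, t))
    (hPreal : ∀ u, Preal u = q (true, u) / ∑ t, q (true, t))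
    (a b : ℝ)
    (ha : a = q (true, s') / (q (true, s') + q (false, s')))
    (hb : b = ∑ t, q (true, t)) :
    Psim s' / Preal s' = ((1 - a) / a) / ((1 - b) / b) := by
  have hsum : ∑ t, q (true, t) + ∑ t, q (false, t) = 1 := by
    rw [← hq1, Fintype.sum_prod_type, Fintype.sum_bool]
  have hT : 0 < ∑ t, q (true, t) :=
    hqt.trans_le (Finset.single_le_sum (f := fun t => q (true, t))
      (fun t _ => hq0 (true, t)) (Finset.mem_univ s'))
  have hodds : (1 - a) / a = q (false, s') / q (true, s') := by
    have hden : 0 < q (true, s') + q (false, s') := add_pos_of_pos_of_nonneg hqt (hq0 _)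
    rw [ha, one_sub_div hden.ne', div_div_div_cancel_right₀ hden.ne', add_sub_cancel_left]
  have hb' : 1 - b = ∑ t, q (false, t) := by
    rw [hb, ← hsum, add_sub_cancel_left]
  rw [hodds, hb', hb, hPsim, hPreal]
  field_simp
end
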